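/- Let n ≥ 3. There exists a family (H_i)_{i∈I} of subgroups of SL(n,ℤ), indexed by a set I of cardinality 2^{ℵ₀} with i ↦ H_i injective, such that every H_i is profinitely dense and of infinite index in SL(n,ℤ), and for all i ≠ j the subgroup generated by H_i ∪ H_j is all of SL(n,ℤ). -/

import Mathlib

/- Common setup: `SL(n,ℤ)`, `SL(n,ℝ)`, the real projective space `ℙ^{n-1}(ℝ)`
with its quotient topology and the projective action, rank-1 unipotent elements
and their attracting points / fixed hyperplanes, metrics compatible with the
topology of `ℙ`, `ε`-neighbourhoods, Schottky systems, profinite density,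
maximal subgroups, and lattices in `SL(n,ℝ)`. -/

open Matrix LinearAlgebra.Projectivization

abbrev SLZ (n : ℕ) := Matrix.SpecialLinearGroup (Fin n) ℤ

abbrev SLR (n : ℕ) := Matrix.SpecialLinearGroup (Fin n) ℝ

/-- The real projective space `ℙ^{n-1}(ℝ)`: the projectivization of `ℝⁿ`. -/
abbrev Proj (n : ℕ) := Projectivization ℝ (Fin n → ℝ)

/-- The quotient topology on `ℙ^{n-1}(ℝ)`. -/
noncomputable instance (n : ℕ) : TopologicalSpace (Proj n) :=
  inferInstanceAs (TopologicalSpace (Quotient _))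

/-- The action of `SL(n,ℝ)` on `ℙ^{n-1}(ℝ)` induced by the linear action on `ℝⁿ`. -/
noncomputable def actR {n : ℕ} (g : SLR n) (x : Proj n) : Proj n :=
  Projectivization.map (Matrix.SpecialLinearGroup.toLin' g).toLinearMap
    (Matrix.SpecialLinearGroup.toLin' g).injective x

/-- The action of `SL(n,ℤ)` on `ℙ^{n-1}(ℝ)` induced by the linear action on `ℝⁿ`. -/
noncomputable def act {n : ℕ} (g : SLZ n) (x : Proj n) : Proj n :=
  actR (Matrix.SpecialLinearGroup.map (Int.castRingHom ℝ) g) x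

/-- The real matrix attached to `g ∈ SL(n,ℤ)`. -/
noncomputable def matR {n : ℕ} (g : SLZ n) : Matrix (Fin n) (Fin n) ℝ :=
  ((Matrix.SpecialLinearGroup.map (Int.castRingHom ℝ)) g : Matrix (Fin n) (Fin n) ℝ)

/-- The subspace `Im(u - I) ⊆ ℝⁿ` (a line when `u` is rank-1 unipotent). -/
noncomputable def lineOf {n : ℕ} (u : SLZ n) : Submodule ℝ (Fin n → ℝ) :=
  LinearMap.range (Matrix.mulVecLin (matR u - 1))

/-- The subspace `ker(u - I) ⊆ ℝⁿ` (a hyperplane when `u` is rank-1 unipotent). -/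
noncomputable def hypOf {n : ℕ} (u : SLZ n) : Submodule ℝ (Fin n → ℝ) :=
  LinearMap.ker (Matrix.mulVecLin (matR u - 1))

/-- The rational matrix attached to `g ∈ SL(n,ℤ)`. -/
noncomputable def matQ {n : ℕ} (g : SLZ n) : Matrix (Fin n) (Fin n) ℚ :=
  ((Matrix.SpecialLinearGroup.map (Int.castRingHom ℚ)) g : Matrix (Fin n) (Fin n) ℚ)

/-- `g - I`, as a `ℚ`-linear endomorphism of `ℚⁿ`. -/
noncomputable def linQ {n : ℕ} (g : SLZ n) : (Fin n → ℚ) →ₗ[ℚ] (Fin n → ℚ) :=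
  Matrix.mulVecLin (matQ g - 1)

/-- `u` is a rank-1 unipotent element of `SL(n,ℤ)`: `u - I` is nilpotent of rank one. -/
def IsR1U {n : ℕ} (u : SLZ n) : Prop :=
  IsNilpotent (linQ u) ∧ Module.finrank ℚ (LinearMap.range (linQ u)) = 1

/-- The point of attraction `p_u` of `u`, as a subset of `ℙ` (a singleton when `u` is a
rank-1 unipotent): the projective points whose representative spans `Im(u - I)`. -/
def attSet {n : ℕ} (u : SLZ n) : Set (Proj n) :=
  {x | x.submodule = lineOf u}

/-- The fixed hyperplane `L_u` of `u`, as a subset of `ℙ`. -/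
def fixSet {n : ℕ} (u : SLZ n) : Set (Proj n) :=
  {x | x.submodule ≤ hypOf u}

/-- The subset of `ℙ` corresponding to a linear subspace `W ⊆ ℝⁿ`. -/
def projSet {n : ℕ} (W : Submodule ℝ (Fin n → ℝ)) : Set (Proj n) :=
  {x | x.submodule ≤ W}

/-- The image `g • W` of a subspace of `ℝⁿ` under `g ∈ SL(n,ℤ)`. -/
noncomputable def actSub {n : ℕ} (g : SLZ n) (W : Submodule ℝ (Fin n → ℝ)) :
    Submodule ℝ (Fin n → ℝ) :=
  Submodule.map (Matrix.mulVecLin (matR g)) W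

/-- The image `g • W` of a subspace of `ℝⁿ` under `g ∈ SL(n,ℝ)`. -/
noncomputable def actSubR {n : ℕ} (g : SLR n) (W : Submodule ℝ (Fin n → ℝ)) :
    Submodule ℝ (Fin n → ℝ) :=
  Submodule.map (Matrix.mulVecLin (g : Matrix (Fin n) (Fin n) ℝ)) W

/-- `d` is a metric on `ℙ^{n-1}(ℝ)` inducing the quotient topology. -/
structure IsCompatMetric {n : ℕ} (d : Proj n → Proj n → ℝ) : Prop where
  self : ∀ x, d x x = 0
  eq_of : ∀ x y, d x y = 0 → x = y
  symm : ∀ x y, d x y = d y x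
  triangle : ∀ x y z, d x z ≤ d x y + d y z
  inducing : ∀ s : Set (Proj n), IsOpen s ↔ ∀ x ∈ s, ∃ ε > 0, ∀ y, d x y < ε → y ∈ s

/-- The distance from a point to a set. -/
noncomputable def setDist {n : ℕ} (d : Proj n → Proj n → ℝ) (x : Proj n)
    (A : Set (Proj n)) : ℝ :=
  sInf (d x '' A)

/-- The open `ε`-neighbourhood `(A)_ε = {x | dist(x, A) < ε}`. -/
def oThick {n : ℕ} (d : Proj n → Proj n → ℝ) (A : Set (Proj n)) (ε : ℝ) : Set (Proj n) :=
  {x | setDist d x A < ε}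

/-- The closed `ε`-neighbourhood `[A]_ε = {x | dist(x, A) ≤ ε}`. -/
def cThick {n : ℕ} (d : Proj n → Proj n → ℝ) (A : Set (Proj n)) (ε : ℝ) : Set (Proj n) :=
  {x | setDist d x A ≤ ε}

/-- The Hausdorff distance between two subsets of `ℙ`. -/
noncomputable def hDist {n : ℕ} (d : Proj n → Proj n → ℝ) (A B : Set (Proj n)) : ℝ :=
  max (sSup ((fun a => setDist d a B) '' A)) (sSup ((fun b => setDist d b A) '' B))

/-- A rational point of `ℙ`: one spanned by a vector of `ℚⁿ`. -/
def RatPoint {n : ℕ} (p : Proj n) : Prop :=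
  ∃ v : Fin n → ℚ, p.submodule = Submodule.span ℝ {fun i => ((v i : ℝ))}

/-- A subspace of `ℝⁿ` spanned by vectors of `ℚⁿ`. -/
def IsRatSubmodule {n : ℕ} (W : Submodule ℝ (Fin n → ℝ)) : Prop :=
  ∃ T : Set (Fin n → ℚ),
    W = Submodule.span ℝ ((fun (v : Fin n → ℚ) (i : Fin n) => ((v i : ℝ))) '' T)

/-- A Schottky system `(S, 𝒜, ℛ)` with respect to the metric `d`: `S` is a nonempty
set of rank-1 unipotents, `𝒜 ⊆ ℛ` are closed, and for each `u ∈ S` there are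
`δ_u ≥ ε_u > 0` satisfying the ping-pong conditions. -/
structure IsSchottky {n : ℕ} (d : Proj n → Proj n → ℝ) (S : Set (SLZ n))
    (A R : Set (Proj n)) : Prop where
  nonempty : S.Nonempty
  unip : ∀ u ∈ S, IsR1U u
  AsubR : A ⊆ R
  closedA : IsClosed A
  closedR : IsClosed R
  cond : ∃ ε δ : SLZ n → ℝ, (∀ u ∈ S, 0 < ε u ∧ ε u ≤ δ u) ∧
    (∀ u ∈ S, ∀ k : ℤ, k ≠ 0 → ∀ x, x ∉ oThick d (fixSet u) (δ u) →
      act (u ^ k) x ∈ oThick d (attSet u) (ε u)) ∧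
    (∀ u ∈ S, ∀ v ∈ S, u ≠ v → oThick d (attSet u) (ε u) ∩ oThick d (fixSet v) (δ v) = ∅) ∧
    (∀ u ∈ S, oThick d (attSet u) (ε u) ⊆ A) ∧
    (∀ u ∈ S, oThick d (fixSet u) (δ u) ⊆ R)

/-- `H` is profinitely dense in `G`: `HN = G` for every finite-index normal `N ⊴ G`. -/
def ProfinitelyDense {G : Type*} [Group G] (H : Subgroup G) : Prop :=
  ∀ N : Subgroup G, N.Normal → N.FiniteIndex → H ⊔ N = ⊤

/-- `M` is a maximal (proper) subgroup of `G`. -/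
def IsMaxSubgroup {G : Type*} [Group G] (M : Subgroup G) : Prop :=
  M ≠ ⊤ ∧ ∀ K : Subgroup G, M < K → K = ⊤

noncomputable instance (n : ℕ) : TopologicalSpace (SLR n) :=
  inferInstanceAs (TopologicalSpace {A : Matrix (Fin n) (Fin n) ℝ // A.det = 1})

noncomputable instance (n : ℕ) : MeasurableSpace (SLR n) := borel _

/-- `Γ ≤ SL(n,ℝ)` is a lattice: a discrete subgroup admitting a Borel fundamental
domain of finite Haar measure. -/
def IsLatticeIn {n : ℕ} (Γ : Subgroup (SLR n)) : Prop :=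
  DiscreteTopology Γ ∧
  ∃ μ : MeasureTheory.Measure (SLR n), μ.IsHaarMeasure ∧
    ∃ D : Set (SLR n), MeasurableSet D ∧ μ D < ⊤ ∧
      ∀ g : SLR n, ∃! γ : Γ, (γ : SLR n)⁻¹ * g ∈ D

namespace Matrix.SpecialLinearGroup
variable {ι : Type*} [Fintype ι] [DecidableEq ι]

/-- The elementary matrices `1 + E_{ab}`. -/
def elementary (ι : Type*) [Fintype ι] [DecidableEq ι] : Set (SpecialLinearGroup ι ℤ) :=
  {g | ∃ (a b : ι) (h : a ≠ b), g = transvection h 1}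

lemma transvection_eq_zpow {a b : ι} (h : a ≠ b) (z : ℤ) :
    transvection h z = (transvection h 1 : SpecialLinearGroup ι ℤ) ^ z := by
  induction z with
  | zero => simp
  | succ k ih => rw [transvection_add, ih, _root_.zpow_add_one]
  | pred k ih => rw [sub_eq_add_neg, transvection_add, ih, ← transvection_inv, ← sub_eq_add_neg,
      _root_.zpow_sub_one]

lemma transvection_mem_closure {a b : ι} (h : a ≠ b) (z : ℤ) :
    transvection h z ∈ Subgroup.closure (elementary ι) := by
  rw [transvection_eq_zpow]
  exact Subgroup.zpow_mem _ (Subgroup.subset_closure (show _ ∈ elementary ι from ⟨a, b, h, rfl⟩)) z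

lemma transvection_mul_apply {a b : ι} (h : a ≠ b) (z : ℤ) (g : SpecialLinearGroup ι ℤ) (i j : ι) :
    (transvection h z * g) i j = g i j + if i = a then z * g b j else 0 := by
  change (Matrix.transvection a b z * (g : Matrix ι ι ℤ)) i j = _
  split_ifs with hi
  · subst hi; simp
  · simp [hi]

lemma transvection_mul_apply_of_ne {a b j : ι} (h : a ≠ b) (z : ℤ) (g : SpecialLinearGroup ι ℤ)
    (hg : ∀ i, g i j = (1 : Matrix ι ι ℤ) i j) (hj : b ≠ j) (i : ι) :
    (transvection h z * g) i j = (1 : Matrix ι ι ℤ) i j := by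
  rw [transvection_mul_apply, hg, hg]
  simp [Matrix.one_apply_ne hj]

lemma natAbs_sub_ediv_mul_lt (x : ℤ) {y : ℤ} (hy : y ≠ 0) :
    (x + -(x / y) * y).natAbs < y.natAbs := by
  have h1 := Int.emod_lt_abs x hy
  have h2 := Int.emod_nonneg x hy
  have h3 := Int.emod_add_mul_ediv x y
  have h4 : x + -(x / y) * y = x % y := by linarith
  rw [Int.abs_eq_natAbs] at h1
  omega

/-- If `g` fixes the basis vectors outside `S`, it is a product of elementary matrices. -/
lemma mem_closure_elementary_of_fixes (S : Finset ι) (g : SpecialLinearGroup ι ℤ)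
    (hg : ∀ j ∉ S, ∀ i, g i j = (1 : Matrix ι ι ℤ) i j) :
    g ∈ Subgroup.closure (elementary ι) := by
  induction S using Finset.induction_on generalizing g with
  | empty =>
    have : g = 1 := by ext i j; simpa using hg j (by simp) i
    rw [this]; exact one_mem _
  | insert p S hp IH =>
    induction hN : ∑ i, (g i p).natAbs using Nat.strong_induction_on generalizing g with
    | _ N ih =>
    have hstep : ∀ {a b : ι} (h : a ≠ b) (z : ℤ), b ∈ insert p S →
        ∀ j ∉ insert p S, ∀ i, (transvection h z * g) i j = (1 : Matrix ι ι ℤ) i j :=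
      fun h z hb j hj => transvection_mul_apply_of_ne h z g (hg j hj) (ne_of_mem_of_not_mem hb hj)
    by_cases hred : ∃ r ∈ insert p S, g r p ≠ 0 ∧ ∃ i, i ≠ r ∧ (g r p).natAbs ≤ (g i p).natAbs
    · obtain ⟨r, hr, hr0, i, hir, hle⟩ := hred
      rw [← Subgroup.mul_mem_cancel_left _ (transvection_mem_closure hir (-(g i p / g r p)))]
      refine ih _ ?_ _ (hstep hir _ hr) rfl
      rw [← hN]
      refine Finset.sum_lt_sum (fun k _ => ?_) ⟨i, Finset.mem_univ _, ?_⟩ <;>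
        rw [transvection_mul_apply]
      · split_ifs with hk
        · subst hk
          exact ((natAbs_sub_ediv_mul_lt _ hr0).trans_le hle).le
        · simp
      · rw [if_pos rfl]
        exact (natAbs_sub_ediv_mul_lt _ hr0).trans_le hle
    push Not at hred
    have hinv : ∀ l ∉ insert p S, g⁻¹ p l = 0 := by
      intro l hl
      have h1 : ((g⁻¹ * g : SpecialLinearGroup ι ℤ) : Matrix ι ι ℤ) p l = 0 := by
        rw [inv_mul_cancel]
        refine Matrix.one_apply_ne ?_
        rintro rfl; exact hl (by simp)
      rw [coe_mul, Matrix.mul_apply] at h1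
      simpa [hg l hl, Matrix.one_apply] using h1
    have h1 : ∑ k, g⁻¹ p k * g k p = 1 := by
      have : ((g⁻¹ * g : SpecialLinearGroup ι ℤ) : Matrix ι ι ℤ) p p = 1 := by simp
      rwa [coe_mul, Matrix.mul_apply] at this
    obtain ⟨r, -, hr⟩ := Finset.exists_ne_zero_of_sum_ne_zero (h1.trans_ne one_ne_zero)
    have hrS : r ∈ insert p S := by
      by_contra h; exact hr (by rw [hinv r h, zero_mul])
    have hr0 : g r p ≠ 0 := right_ne_zero_of_mul hr
    have hsmall := hred r hrS hr0
    have huniq : ∀ k ≠ r, g⁻¹ p k * g k p = 0 := by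
      intro k hk
      by_cases hkS : k ∈ insert p S
      · by_cases hk0 : g k p = 0
        · simp [hk0]
        · exact absurd (hsmall k hk) (hred k hkS hk0 r hk.symm).not_gt
      · rw [hinv k hkS, zero_mul]
    rw [Finset.sum_eq_single r (fun k _ hk => huniq k hk) (by simp)] at h1
    have hunit : (g r p).natAbs = 1 := Int.isUnit_iff_natAbs_eq.1 (.of_mul_eq_one_right _ h1)
    have hcol : ∀ k ≠ r, g k p = 0 := fun k hk => by have := hsmall k hk; omega
    have hfin : ∀ h : SpecialLinearGroup ι ℤ,
        (∀ j ∉ insert p S, ∀ i, h i j = (1 : Matrix ι ι ℤ) i j) →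
        (∀ i, h i p = (1 : Matrix ι ι ℤ) i p) → h ∈ Subgroup.closure (elementary ι) := by
      refine fun h hh hhp => IH h fun j hj i => ?_
      by_cases hjp : j = p
      · rw [hjp, hhp]
      · exact hh j (by simp [hj, hjp]) i
    by_cases hrp : r = p
    · subst hrp
      rcases Int.natAbs_eq_iff.1 hunit with h1 | h1
      · refine hfin g hg fun i => ?_
        by_cases hi : i = r
        · subst hi; simpa using h1
        · rw [hcol i hi, Matrix.one_apply_ne hi]
      · rcases S.eq_empty_or_nonempty with rfl | ⟨s, hs⟩
        · have hgu : (g : Matrix ι ι ℤ) = (1 : Matrix ι ι ℤ).updateCol r (Pi.single r (-1)) := by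
            ext i j
            by_cases hj : j = r
            · subst hj
              by_cases hi : i = j
              · subst hi; simpa using h1
              · simp [hi, hcol i hi]
            · simp [Matrix.updateCol_ne hj, hg j (by simpa using hj) i]
          have hd := g.det_coe
          rw [hgu, ← Matrix.cramer_apply, Matrix.cramer_one] at hd
          simp at hd
        · have hsr : s ≠ r := by rintro rfl; exact hp hs
          have hsS : s ∈ insert r S := Finset.mem_insert_of_mem hs
          rw [← Subgroup.mul_mem_cancel_left _ (transvection_mem_closure hsr (-1)),
            ← Subgroup.mul_mem_cancel_left _ (transvection_mem_closure hsr.symm 2),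
            ← Subgroup.mul_mem_cancel_left _ (transvection_mem_closure hsr (-1))]
          refine hfin _ (fun j hj => ?_) fun i => ?_
          · have hs' := ne_of_mem_of_not_mem hsS hj
            have hr' := ne_of_mem_of_not_mem hrS hj
            exact transvection_mul_apply_of_ne _ _ _ (transvection_mul_apply_of_ne _ _ _
              (transvection_mul_apply_of_ne _ _ _ (hg j hj) hr') hs') hr'
          · have := hcol s hsr
            have := hcol i
            simp only [transvection_mul_apply, Matrix.one_apply]
            grind
    · rw [← Subgroup.mul_mem_cancel_left _ (transvection_mem_closure (Ne.symm hrp) (g r p)),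
        ← Subgroup.mul_mem_cancel_left _ (transvection_mem_closure hrp (-g r p))]
      refine hfin _ (fun j hj => ?_) fun i => ?_
      · exact transvection_mul_apply_of_ne _ _ _ (transvection_mul_apply_of_ne _ _ _ (hg j hj)
          (ne_of_mem_of_not_mem hrS hj)) (ne_of_mem_of_not_mem (Finset.mem_insert_self p S) hj)
      · have h2 : g r p * g r p = 1 := by rw [← Int.natAbs_mul_self' , hunit]; rfl
        have := hcol p (Ne.symm hrp)
        have := hcol i
        simp only [transvection_mul_apply, Matrix.one_apply]
        grind

lemma closure_elementary : Subgroup.closure (elementary ι) = ⊤ :=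
  eq_top_iff.2 fun g _ => mem_closure_elementary_of_fixes Finset.univ g (by simp)

end Matrix.SpecialLinearGroup

section PingPong
variable {ι : Type*} [Fintype ι]

/-- The `ℓ¹`-norm of an integer vector. -/
def l1 (x : ι → ℤ) : ℤ := ∑ i, |x i|

lemma l1_nonneg (x : ι → ℤ) : 0 ≤ l1 x := Finset.sum_nonneg fun _ _ => abs_nonneg _

lemma abs_apply_le_l1 (x : ι → ℤ) (i : ι) : |x i| ≤ l1 x :=
  Finset.single_le_sum (f := fun i => |x i|) (fun _ _ => abs_nonneg _) (Finset.mem_univ i)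

lemma l1_pos {x : ι → ℤ} (hx : x ≠ 0) : 0 < l1 x := by
  obtain ⟨i, hi⟩ := Function.ne_iff.1 hx
  exact (abs_pos.2 hi).trans_le (abs_apply_le_l1 x i)

lemma l1_add_le (x y : ι → ℤ) : l1 (x + y) ≤ l1 x + l1 y := by
  rw [l1, l1, l1, ← Finset.sum_add_distrib]
  exact Finset.sum_le_sum fun i _ => abs_add_le _ _

lemma l1_smul (c : ℤ) (x : ι → ℤ) : l1 (c • x) = |c| * l1 x := by
  simp [l1, abs_mul, Finset.mul_sum]

lemma l1_single [DecidableEq ι] (i : ι) (c : ℤ) : l1 (Pi.single i c) = |c| := by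
  rw [l1, Finset.sum_eq_single i] <;> simp +contextual

lemma abs_dotProduct_le (φ x : ι → ℤ) : |φ ⬝ᵥ x| ≤ l1 φ * l1 x := by
  rw [l1, Finset.sum_mul]
  refine (Finset.abs_sum_le_sum_abs _ _).trans (Finset.sum_le_sum fun i _ => ?_)
  rw [abs_mul]
  exact mul_le_mul_of_nonneg_left (abs_apply_le_l1 x i) (abs_nonneg _)

/-- The vectors reached from `x₀` by nontrivial reduced words in the transvections
`x ↦ x + φ k x • v k`, the last letter having index `k`. -/
inductive PingPongOrbit {κ : Type*} (v φ : κ → ι → ℤ) (x₀ : ι → ℤ) : κ → (ι → ℤ) → Prop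
  | base (k : κ) (c : ℤ) (hc : c ≠ 0) : PingPongOrbit v φ x₀ k (x₀ + (c * (φ k ⬝ᵥ x₀)) • v k)
  | step (j k : κ) (c : ℤ) (x : ι → ℤ) (hjk : j ≠ k) (hx : PingPongOrbit v φ x₀ j x) (hc : c ≠ 0) :
      PingPongOrbit v φ x₀ k (x + (c * (φ k ⬝ᵥ x)) • v k)

variable {κ : Type*} {v φ : κ → ι → ℤ} {x₀ : ι → ℤ}

lemma dotProduct_add_smul_self {v φ : ι → ℤ} (h : φ ⬝ᵥ v = 0) (x : ι → ℤ) (c : ℤ) :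
    φ ⬝ᵥ (x + c • v) = φ ⬝ᵥ x := by
  rw [dotProduct_add, dotProduct_smul, h, smul_zero, add_zero]

lemma pingPongOrbit_add_smul (h0 : ∀ k, φ k ⬝ᵥ v k = 0) (k : κ) (e : ℤ) {x : ι → ℤ}
    (hx : x = x₀ ∨ ∃ j, PingPongOrbit v φ x₀ j x) :
    x + (e * (φ k ⬝ᵥ x)) • v k = x₀ ∨
      ∃ j, PingPongOrbit v φ x₀ j (x + (e * (φ k ⬝ᵥ x)) • v k) := by
  have hmerge : ∀ (y : ι → ℤ) (c : ℤ), y + (c * (φ k ⬝ᵥ y)) • v k +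
      (e * (φ k ⬝ᵥ (y + (c * (φ k ⬝ᵥ y)) • v k))) • v k = y + ((c + e) * (φ k ⬝ᵥ y)) • v k := by
    intro y c
    rw [dotProduct_add_smul_self (h0 k), add_assoc, ← add_smul, add_mul]
  by_cases he : e = 0
  · simpa [he] using hx
  rcases hx with rfl | ⟨j, hj⟩
  · exact .inr ⟨k, .base k e he⟩
  by_cases hjk : j = k
  · subst hjk
    cases hj with
    | base _ c hc =>
      rw [hmerge]
      by_cases hce : c + e = 0
      · simp [hce]
      · exact .inr ⟨j, .base j _ hce⟩
    | step i _ c y hij hy hc =>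
      rw [hmerge]
      by_cases hce : c + e = 0
      · right; exact ⟨i, by simpa [hce] using hy⟩
      · exact .inr ⟨j, .step i j _ y hij hy hce⟩
  · exact .inr ⟨k, .step j k e x hjk hj he⟩

lemma exists_l1_sub_smul_le {v φ x : ι → ℤ} (hx : x ≠ 0) (hφ : l1 x ≤ |φ ⬝ᵥ x|) {c : ℤ}
    (hc : c ≠ 0) : ∃ t : ℤ, t ≠ 0 ∧ l1 (x + (c * (φ ⬝ᵥ x)) • v - t • v) ≤ |t| := by
  have h1 := l1_pos hx
  refine ⟨c * (φ ⬝ᵥ x), mul_ne_zero hc (abs_pos.1 (h1.trans_le hφ)), ?_⟩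
  rw [add_sub_cancel_right, abs_mul]
  nlinarith [Int.one_le_abs hc]

lemma l1_le_of_near {v φ x : ι → ℤ} (hc : l1 v + l1 φ + 1 ≤ |φ ⬝ᵥ v|) {t : ℤ}
    (hx : l1 (x - t • v) ≤ |t|) : l1 x ≤ |φ ⬝ᵥ x| := by
  obtain ⟨y, rfl⟩ : ∃ y, x = t • v + y := ⟨x - t • v, by abel⟩
  rw [add_sub_cancel_left] at hx
  have h1 := l1_add_le (t • v) y
  rw [l1_smul] at h1
  have h2 := abs_dotProduct_le φ y
  have h3 : |t| * |φ ⬝ᵥ v| ≤ |φ ⬝ᵥ (t • v + y)| + |φ ⬝ᵥ y| := by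
    rw [dotProduct_add, dotProduct_smul, smul_eq_mul, ← abs_mul]
    simpa using abs_sub (t * (φ ⬝ᵥ v) + φ ⬝ᵥ y) (φ ⬝ᵥ y)
  nlinarith [l1_nonneg φ, abs_nonneg t, mul_le_mul_of_nonneg_left hc (abs_nonneg t),
    mul_le_mul_of_nonneg_left hx (l1_nonneg φ)]

lemma PingPongOrbit.near (q : ι) (hq : ∀ k, 2 ≤ |v k q|)
    (hc : ∀ j k, j ≠ k → l1 (v j) + l1 (φ k) + 1 ≤ |φ k ⬝ᵥ v j|)
    (hx₀ : x₀ ≠ 0) (hφ : ∀ k, l1 x₀ ≤ |φ k ⬝ᵥ x₀|) {k : κ} {x : ι → ℤ}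
    (h : PingPongOrbit v φ x₀ k x) : x q ≠ 0 ∧ ∃ t : ℤ, t ≠ 0 ∧ l1 (x - t • v k) ≤ |t| := by
  have key : ∀ {x : ι → ℤ} {k}, (∃ t : ℤ, t ≠ 0 ∧ l1 (x - t • v k) ≤ |t|) → x q ≠ 0 := by
    rintro x k ⟨t, ht, hxt⟩ h0
    have h1 := (abs_apply_le_l1 _ q).trans hxt
    rw [Pi.sub_apply, h0, zero_sub, abs_neg, Pi.smul_apply, smul_eq_mul, abs_mul] at h1
    nlinarith [abs_pos.2 ht, hq k]
  suffices h : ∃ t : ℤ, t ≠ 0 ∧ l1 (x - t • v k) ≤ |t| from ⟨key h, h⟩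
  induction h with
  | base k c hc => exact exists_l1_sub_smul_le hx₀ (hφ k) hc
  | step j k c x hjk _ hc0 ih =>
    refine exists_l1_sub_smul_le (fun h => key ih (by simp [h])) ?_ hc0
    obtain ⟨t, -, hxt⟩ := ih
    exact l1_le_of_near (hc j k hjk) hxt

variable [DecidableEq ι]

/-- `t` is the transvection `x ↦ x + φ x • v`. -/
structure IsTransvection (t : SpecialLinearGroup ι ℤ) (v φ : ι → ℤ) : Prop where
  coe_eq : (t : Matrix ι ι ℤ) = 1 + vecMulVec v φ
  dotProduct_eq_zero : φ ⬝ᵥ v = 0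

namespace IsTransvection
variable {t : SpecialLinearGroup ι ℤ} {v φ : ι → ℤ}

lemma mulVec (h : IsTransvection t v φ) (x : ι → ℤ) :
    (t : Matrix ι ι ℤ) *ᵥ x = x + (φ ⬝ᵥ x) • v := by
  rw [h.coe_eq, add_mulVec, one_mulVec, vecMulVec_mulVec]
  simp

lemma inv_mulVec (h : IsTransvection t v φ) (x : ι → ℤ) :
    ((t⁻¹ : SpecialLinearGroup ι ℤ) : Matrix ι ι ℤ) *ᵥ x = x + (-(φ ⬝ᵥ x)) • v := by
  have h1 : (t : Matrix ι ι ℤ) *ᵥ (x + (-(φ ⬝ᵥ x)) • v) = x := by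
    rw [h.mulVec, dotProduct_add_smul_self h.dotProduct_eq_zero, neg_smul, neg_add_cancel_right]
  conv_lhs => rw [← h1]
  rw [mulVec_mulVec, ← Matrix.SpecialLinearGroup.coe_mul, inv_mul_cancel,
    Matrix.SpecialLinearGroup.coe_one,
    one_mulVec]

lemma conj (h : IsTransvection t v φ) (g : SpecialLinearGroup ι ℤ) :
    IsTransvection (g * t * g⁻¹) ((g : Matrix ι ι ℤ) *ᵥ v)
      (φ ᵥ* ((g⁻¹ : SpecialLinearGroup ι ℤ) : Matrix ι ι ℤ)) := by
  constructor
  · rw [Matrix.SpecialLinearGroup.coe_mul, Matrix.SpecialLinearGroup.coe_mul, h.coe_eq, mul_add,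
      add_mul, mul_one,
      ← Matrix.SpecialLinearGroup.coe_mul, mul_inv_cancel, Matrix.SpecialLinearGroup.coe_one,
      mul_vecMulVec,
      vecMulVec_mul]
  · rw [← dotProduct_mulVec, mulVec_mulVec, ← Matrix.SpecialLinearGroup.coe_mul, inv_mul_cancel,
      Matrix.SpecialLinearGroup.coe_one, one_mulVec, h.dotProduct_eq_zero]

lemma inv_vecMul (h : IsTransvection t v φ) (y : ι → ℤ) :
    y ᵥ* ((t⁻¹ : SpecialLinearGroup ι ℤ) : Matrix ι ι ℤ) = y - (y ⬝ᵥ v) • φ := by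
  have h1 : (y - (y ⬝ᵥ v) • φ) ᵥ* (t : Matrix ι ι ℤ) = y := by
    rw [h.coe_eq, vecMul_add, vecMul_one, vecMul_vecMulVec, sub_dotProduct, smul_dotProduct,
      h.dotProduct_eq_zero]
    simp
  conv_lhs => rw [← h1]
  rw [vecMul_vecMul, ← Matrix.SpecialLinearGroup.coe_mul, mul_inv_cancel,
    Matrix.SpecialLinearGroup.coe_one,
    vecMul_one]

lemma pow (h : IsTransvection t v φ) (k : ℕ) : IsTransvection (t ^ k) ((k : ℤ) • v) φ := by
  constructor
  · induction k with
    | zero => simp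
    | succ k ih =>
      rw [pow_succ, Matrix.SpecialLinearGroup.coe_mul, ih, h.coe_eq, mul_add, mul_one, add_mul,
        one_mul,
        vecMulVec_mul_vecMulVec, smul_vecMulVec, h.dotProduct_eq_zero]
      ext i j
      simp only [Matrix.add_apply, Matrix.smul_apply, vecMulVec_apply, Pi.smul_apply, smul_eq_mul,
        zero_smul, Pi.zero_apply, Nat.cast_succ]
      ring
  · rw [dotProduct_smul, h.dotProduct_eq_zero, smul_zero]

lemma of_transvection {a b : ι} (h : a ≠ b) :
    IsTransvection (SpecialLinearGroup.transvection h 1) (Pi.single a 1) (Pi.single b 1) := by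
  refine ⟨?_, by simp [h.symm]⟩
  rw [SpecialLinearGroup.transvection_coe, Matrix.single_eq_single_vecMulVec_single]

end IsTransvection

/-- **Ping-pong** for transvections. -/
theorem mulVec_of_mem_closure_transvections {t : κ → SpecialLinearGroup ι ℤ}
    (ht : ∀ k, IsTransvection (t k) (v k) (φ k)) (q : ι) (hq : ∀ k, 2 ≤ |v k q|)
    (hc : ∀ j k, j ≠ k → l1 (v j) + l1 (φ k) + 1 ≤ |φ k ⬝ᵥ v j|)
    (hx₀ : x₀ ≠ 0) (hφ : ∀ k, l1 x₀ ≤ |φ k ⬝ᵥ x₀|) {g : SpecialLinearGroup ι ℤ}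
    (hg : g ∈ Subgroup.closure (Set.range t)) :
    (g : Matrix ι ι ℤ) *ᵥ x₀ = x₀ ∨ ((g : Matrix ι ι ℤ) *ᵥ x₀) q ≠ 0 := by
  suffices h : (g : Matrix ι ι ℤ) *ᵥ x₀ = x₀ ∨
      ∃ k, PingPongOrbit v φ x₀ k ((g : Matrix ι ι ℤ) *ᵥ x₀) from
    h.imp_right fun ⟨k, hk⟩ => (hk.near q hq hc hx₀ hφ).1
  have h0 := fun k => (ht k).dotProduct_eq_zero
  induction hg using Subgroup.closure_induction_left with
  | one => simp
  | mul_left s hs y _ ih =>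
    obtain ⟨k, rfl⟩ := hs
    rw [Matrix.SpecialLinearGroup.coe_mul, ← mulVec_mulVec, (ht k).mulVec]
    simpa using pingPongOrbit_add_smul h0 k 1 ih
  | inv_mul_cancel s hs y _ ih =>
    obtain ⟨k, rfl⟩ := hs
    rw [Matrix.SpecialLinearGroup.coe_mul, ← mulVec_mulVec, (ht k).inv_mulVec]
    simpa using pingPongOrbit_add_smul h0 k (-1) ih
end PingPong

section Players
variable {ι : Type*} [Fintype ι] [DecidableEq ι] {p q : ι}

/-- A transvection suited for ping-pong with respect to the coordinates `p` and `q`. -/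
structure Player (p q : ι) where
  t : SpecialLinearGroup ι ℤ
  v : ι → ℤ
  φ : ι → ℤ
  isTransvection : IsTransvection t v φ
  two_le_abs_v : 2 ≤ |v q|
  two_le_abs_φ : 2 ≤ |φ p|

/-- Two transvections that can play ping-pong against each other. -/
def Player.Compat (P Q : Player p q) : Prop :=
  l1 P.v + l1 Q.φ + 1 ≤ |Q.φ ⬝ᵥ P.v| ∧ l1 Q.v + l1 P.φ + 1 ≤ |P.φ ⬝ᵥ Q.v|

/-- Conjugation of a player by a power of the elementary matrix `1 + E_{pq}`. -/
def Player.conj (h : p ≠ q) (P : Player p q) (k : ℕ) : Player p q where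
  t := SpecialLinearGroup.transvection h 1 ^ k * P.t * (SpecialLinearGroup.transvection h 1 ^ k)⁻¹
  v := P.v + (k * P.v q) • Pi.single p 1
  φ := P.φ + (k * -P.φ p) • Pi.single q 1
  isTransvection := by
    have hx := (IsTransvection.of_transvection h).pow k
    convert P.isTransvection.conj (SpecialLinearGroup.transvection h 1 ^ k) using 1
    · rw [hx.mulVec, smul_smul, single_dotProduct, one_mul, mul_comm]
    · rw [hx.inv_vecMul, dotProduct_smul, dotProduct_single, sub_eq_add_neg, ← neg_smul]
      simp
  two_le_abs_v := by simpa [h.symm] using P.two_le_abs_v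
  two_le_abs_φ := by simpa [h] using P.two_le_abs_φ

lemma eventually_l1_add_le (w ψ : ι → ℤ) {a : ℤ} (ha : a ≠ 0) {i : ι} (hψ : 2 ≤ |ψ i|) :
    ∀ᶠ k : ℕ in Filter.atTop, l1 (w + (k * a) • Pi.single i 1) + l1 ψ + 1 ≤
      |ψ ⬝ᵥ (w + (k * a) • Pi.single i 1)| := by
  filter_upwards [Filter.eventually_ge_atTop (l1 w + l1 ψ + 1 + |ψ ⬝ᵥ w|).toNat] with k hk
  have hk' : l1 w + l1 ψ + 1 + |ψ ⬝ᵥ w| ≤ k := Int.toNat_le.1 hk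
  have h1 := l1_add_le w ((k * a : ℤ) • Pi.single i 1)
  rw [l1_smul, l1_single, abs_mul, Nat.abs_cast, abs_one, mul_one] at h1
  have h2 : (k : ℤ) * |a| * |ψ i| ≤ |ψ ⬝ᵥ (w + (k * a : ℤ) • Pi.single i 1)| + |ψ ⬝ᵥ w| := by
    rw [dotProduct_add, dotProduct_smul, dotProduct_single, mul_one, smul_eq_mul]
    have := abs_sub (ψ ⬝ᵥ w + k * a * ψ i) (ψ ⬝ᵥ w)
    rwa [add_sub_cancel_left, abs_mul, abs_mul, Nat.abs_cast] at this
  have h3 := Int.one_le_abs ha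
  have h4 : (k : ℤ) ≤ k * |a| := by nlinarith
  nlinarith [mul_le_mul_of_nonneg_left hψ (by positivity : 0 ≤ (k : ℤ) * |a|)]

lemma Player.eventually_compat (h : p ≠ q) (P Q : Player p q) :
    ∀ᶠ k in Filter.atTop, Q.Compat (P.conj h k) := by
  have hv := P.two_le_abs_v
  have hφ := P.two_le_abs_φ
  filter_upwards [eventually_l1_add_le P.φ Q.v (a := -P.φ p) (by grind) Q.two_le_abs_v,
    eventually_l1_add_le P.v Q.φ (a := P.v q) (by grind) Q.two_le_abs_φ] with k h1 h2
  refine ⟨?_, h2⟩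
  rw [dotProduct_comm, add_comm (l1 Q.v)]
  exact h1

/-- `R` contains players compatible with any prescribed finite set of players. -/
def Large (p q : ι) (R : Set (SpecialLinearGroup ι ℤ)) : Prop :=
  ∀ s : Finset (Player p q), ∃ P : Player p q, P.t ∈ R ∧ ∀ Q ∈ s, Q.Compat P

lemma exists_player_seq {R : ℕ → Set (SpecialLinearGroup ι ℤ)} (hR : ∀ i, Large p q (R i)) :
    ∃ P : ℕ → Player p q, (∀ i, (P i).t ∈ R i) ∧ ∀ i j, i < j → (P i).Compat (P j) := by
  classical
  choose f hf hc using hR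
  let S : ℕ → Finset (Player p q) := fun n => Nat.rec ∅ (fun i s => insert (f i s) s) n
  have hS : ∀ i j, i < j → f i (S i) ∈ S j := by
    intro i j hij
    induction j, hij using Nat.le_induction with
    | base => exact Finset.mem_insert_self _ _
    | succ j _ ih => exact Finset.mem_insert_of_mem ih
  exact ⟨fun i => f i (S i), fun i => hf i _, fun i j hij => hc j _ _ (hS i j hij)⟩

lemma exists_proper_subgroup_meeting_seq (hpq : p ≠ q) (h3 : 3 ≤ Fintype.card ι)
    {R : ℕ → Set (SpecialLinearGroup ι ℤ)} (hR : ∀ i, Large p q (R i)) :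
    ∃ H : Subgroup (SpecialLinearGroup ι ℤ), H ≠ ⊤ ∧ ∀ i, ∃ g ∈ H, g ∈ R i := by
  obtain ⟨P, hP, hc⟩ := exists_player_seq hR
  refine ⟨Subgroup.closure (Set.range fun i => (P i).t), fun htop => ?_,
    fun i => ⟨_, Subgroup.subset_closure ⟨i, rfl⟩, hP i⟩⟩
  obtain ⟨r, hr⟩ : ∃ r, r ∉ ({p, q} : Finset ι) := by
    by_contra! h
    have := Finset.card_le_card (fun i _ => h i : Finset.univ ⊆ ({p, q} : Finset ι))
    have := Finset.card_le_two (a := p) (b := q)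
    rw [Finset.card_univ] at *
    omega
  simp only [Finset.mem_insert, Finset.mem_singleton, not_or] at hr
  have hfix := mulVec_of_mem_closure_transvections (x₀ := Pi.single p 1)
    (fun i => (P i).isTransvection) q (fun i => (P i).two_le_abs_v)
    (fun i j hij => (lt_or_gt_of_ne hij).elim (fun h => (hc i j h).1) (fun h => (hc j i h).2))
    (by simp) (fun i => by
      rw [l1_single, dotProduct_single, mul_one]
      have := (P i).two_le_abs_φ
      simp only [abs_one]
      omega)
    (htop ▸ Subgroup.mem_top (SpecialLinearGroup.transvection hr.1 1))
  rw [(IsTransvection.of_transvection hr.1).mulVec] at hfix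
  rcases hfix with h | h
  · simpa [hr.1] using congrFun h r
  · exact h (by simp [Ne.symm hr.2, Ne.symm hpq])

lemma exists_proper_subgroup_meeting (hpq : p ≠ q) (h3 : 3 ≤ Fintype.card ι)
    {𝓡 : Set (Set (SpecialLinearGroup ι ℤ))} (hne : 𝓡.Nonempty) (hct : 𝓡.Countable)
    (hR : ∀ R ∈ 𝓡, Large p q R) :
    ∃ H : Subgroup (SpecialLinearGroup ι ℤ), H ≠ ⊤ ∧ ∀ R ∈ 𝓡, ∃ g ∈ H, g ∈ R := by
  obtain ⟨R, rfl⟩ := hct.exists_eq_range hne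
  obtain ⟨H, hH, h⟩ := exists_proper_subgroup_meeting_seq hpq h3 fun i => hR (R i) ⟨i, rfl⟩
  exact ⟨H, hH, by rintro _ ⟨i, rfl⟩; exact h i⟩

/-- A unipotent matrix moving every coordinate vector along `(1, …, 1)`. -/
def spread (p : ι) : SpecialLinearGroup ι ℤ :=
  ⟨1 + vecMulVec 1 (1 - Pi.single p (Fintype.card ι : ℤ)), by
    rw [vecMulVec_eq Unit, det_one_add_replicateCol_mul_replicateRow]
    simp [dotProduct_one]⟩

lemma isTransvection_spread (p : ι) :
    IsTransvection (spread p) 1 (1 - Pi.single p (Fintype.card ι : ℤ)) :=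
  ⟨rfl, by simp [dotProduct_one]⟩

/-- The player obtained from an elementary matrix by conjugating with a power of `spread p`. -/
def Player.base (hpq : p ≠ q) (h3 : 3 ≤ Fintype.card ι) {m : ℕ} (hm : 2 ≤ m) {a b : ι}
    (h : a ≠ b) : Player p q where
  t := spread p ^ m * SpecialLinearGroup.transvection h 1 * (spread p ^ m)⁻¹
  v := Pi.single a 1 + (1 - Pi.single p (Fintype.card ι : ℤ) : ι → ℤ) a • ((m : ℤ) • 1)
  φ := Pi.single b 1 - (m : ℤ) • (1 - Pi.single p (Fintype.card ι : ℤ))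
  isTransvection := by
    have hx := (isTransvection_spread p).pow m
    convert (IsTransvection.of_transvection h).conj (spread p ^ m) using 1
    · rw [hx.mulVec, dotProduct_single, mul_one]
    · rw [hx.inv_vecMul, single_dotProduct, one_mul]
      simp
  two_le_abs_v := by
    have h3' : (3 : ℤ) ≤ Fintype.card ι := by exact_mod_cast h3
    simp only [Pi.add_apply, Pi.sub_apply, Pi.smul_apply, Pi.one_apply, Pi.single_apply,
      smul_eq_mul]
    rw [le_abs]
    split_ifs
    all_goals first | (left; grind) | (right; nlinarith)
  two_le_abs_φ := by
    have h3' : (3 : ℤ) ≤ Fintype.card ι := by exact_mod_cast h3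
    simp only [Pi.sub_apply, Pi.smul_apply, Pi.one_apply, Pi.single_apply, smul_eq_mul]
    rw [le_abs]
    left
    split_ifs
    all_goals nlinarith

/-- The conjugating elements `x ^ (k * m) * c ^ m`, where `x = 1 + E_{pq}` and `c = spread p`. -/
def mixer (hpq : p ≠ q) (m k : ℕ) : SpecialLinearGroup ι ℤ :=
  SpecialLinearGroup.transvection hpq 1 ^ (k * m) * spread p ^ m

lemma Player.conj_base_t (hpq : p ≠ q) (h3 : 3 ≤ Fintype.card ι) {m : ℕ} (hm : 2 ≤ m) (k : ℕ)
    {a b : ι} (h : a ≠ b) : ((Player.base hpq h3 hm h).conj hpq (k * m)).t =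
      mixer hpq m k * SpecialLinearGroup.transvection h 1 * (mixer hpq m k)⁻¹ := by
  simp only [Player.conj, Player.base, mixer]
  group

lemma eventually_compat_conj_base (hpq : p ≠ q) (h3 : 3 ≤ Fintype.card ι) {m : ℕ} (hm : 2 ≤ m)
    (s : Finset (Player p q)) {a b : ι} (h : a ≠ b) : ∀ᶠ k in Filter.atTop, ∀ Q ∈ s,
      Q.Compat ((Player.base hpq h3 hm h).conj hpq (k * m)) := by
  rw [Filter.eventually_all_finset]
  intro Q _
  exact (Filter.tendsto_id.atTop_mul_const' (by omega : 0 < m)).eventually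
    (Player.eventually_compat hpq _ Q)

lemma large_range_conj (hpq : p ≠ q) (h3 : 3 ≤ Fintype.card ι) {m : ℕ} (hm : 2 ≤ m) {a b : ι}
    (h : a ≠ b) : Large p q (Set.range fun k =>
      mixer hpq m k * SpecialLinearGroup.transvection h 1 * (mixer hpq m k)⁻¹) := by
  intro s
  obtain ⟨k, hk⟩ := (eventually_compat_conj_base hpq h3 hm s h).exists
  exact ⟨_, ⟨k, (Player.conj_base_t hpq h3 hm k h).symm⟩, hk⟩

lemma eq_top_of_conj_elementary {M : Subgroup (SpecialLinearGroup ι ℤ)}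
    (g : SpecialLinearGroup ι ℤ) (h : ∀ e ∈ SpecialLinearGroup.elementary ι, g * e * g⁻¹ ∈ M) :
    M = ⊤ := by
  have h1 : M.comap (MulAut.conj g).toMonoidHom = ⊤ := by
    rw [eq_top_iff, ← SpecialLinearGroup.closure_elementary, Subgroup.closure_le]
    exact h
  rw [eq_top_iff]
  intro y _
  have h2 : g⁻¹ * y * g ∈ M.comap (MulAut.conj g).toMonoidHom := h1 ▸ Subgroup.mem_top _
  simpa [mul_assoc] using h2

lemma large_compl (hpq : p ≠ q) (h3 : 3 ≤ Fintype.card ι) {M : Subgroup (SpecialLinearGroup ι ℤ)}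
    (hM : M ≠ ⊤) : Large p q (M : Set (SpecialLinearGroup ι ℤ))ᶜ := by
  intro s
  have h : ∀ᶠ k in Filter.atTop, ∀ x : {x : ι × ι // x.1 ≠ x.2}, ∀ Q ∈ s,
      Q.Compat ((Player.base hpq h3 le_rfl x.2).conj hpq (k * 2)) :=
    Filter.eventually_all.2 fun x => eventually_compat_conj_base hpq h3 le_rfl s x.2
  obtain ⟨k, hk⟩ := h.exists
  by_contra! hcon
  refine hM (eq_top_of_conj_elementary (mixer hpq 2 k) ?_)
  rintro _ ⟨a, b, hab, rfl⟩
  by_contra hnot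
  obtain ⟨Q, hQ, hQc⟩ := hcon _ (by rwa [← Player.conj_base_t hpq h3 le_rfl] at hnot)
  exact hQc (hk ⟨(a, b), hab⟩ Q hQ)

/-- `H` contains enough conjugates of elementary matrices to be profinitely dense. -/
def IsMixed (hpq : p ≠ q) (H : Subgroup (SpecialLinearGroup ι ℤ)) : Prop :=
  ∀ m, 2 ≤ m → ∀ (a b : ι) (h : a ≠ b), ∃ k,
    mixer hpq m k * SpecialLinearGroup.transvection h 1 * (mixer hpq m k)⁻¹ ∈ H

lemma IsMixed.sup_eq_top {hpq : p ≠ q} {H : Subgroup (SpecialLinearGroup ι ℤ)}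
    (hH : IsMixed hpq H) (N : Subgroup (SpecialLinearGroup ι ℤ)) [N.Normal] [N.FiniteIndex] :
    H ⊔ N = ⊤ := by
  rw [eq_top_iff, ← SpecialLinearGroup.closure_elementary, Subgroup.closure_le]
  rintro _ ⟨a, b, h, rfl⟩
  have hN : N.index ≠ 0 := Subgroup.FiniteIndex.index_ne_zero
  obtain ⟨k, hk⟩ := hH (2 * N.index) (by omega) a b h
  have hg : mixer hpq (2 * N.index) k ∈ N := by
    have hpow : ∀ y : SpecialLinearGroup ι ℤ, y ^ (2 * N.index) ∈ N := fun y => by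
      rw [mul_comm, pow_mul]; exact N.pow_mem (N.pow_index_mem y) 2
    rw [mixer, pow_mul]
    exact N.mul_mem (hpow _) (hpow _)
  set g := mixer hpq (2 * N.index) k
  set e : SpecialLinearGroup ι ℤ := SpecialLinearGroup.transvection h 1
  have he : e = g * e * g⁻¹ * (g * (e⁻¹ * g⁻¹ * e⁻¹⁻¹)) := by group
  have hmem : g * (e⁻¹ * g⁻¹ * e⁻¹⁻¹) ∈ N :=
    N.mul_mem hg (Subgroup.Normal.conj_mem ‹_› _ (N.inv_mem hg) _)
  rw [he]
  exact mul_mem (Subgroup.mem_sup_left hk) (Subgroup.mem_sup_right hmem)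

lemma IsMixed.index_eq_zero {hpq : p ≠ q} {H : Subgroup (SpecialLinearGroup ι ℤ)}
    (hH : IsMixed hpq H) (hne : H ≠ ⊤) : H.index = 0 := by
  by_contra h
  have : H.FiniteIndex := ⟨h⟩
  exact hne (by
    rw [← hH.sup_eq_top H.normalCore, sup_eq_left.2 H.normalCore_le])

end Players

section Measurability
variable {G : Type*} [Group G]

lemma Subgroup.mem_closure_iff_exists_finset {S : Set G} {x : G} :
    x ∈ Subgroup.closure S ↔ ∃ T : Finset G, x ∈ Subgroup.closure (T : Set G) ∧ (T : Set G) ⊆ S :=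
    by
  classical
  refine ⟨fun hx => ?_, fun ⟨T, hx, hT⟩ => Subgroup.closure_mono hT hx⟩
  induction hx using Subgroup.closure_induction with
  | mem x hx => exact ⟨{x}, Subgroup.subset_closure (by simp), by simpa using hx⟩
  | one => exact ⟨∅, one_mem _, by simp⟩
  | mul x y _ _ ihx ihy =>
    obtain ⟨T, hx, hT⟩ := ihx
    obtain ⟨U, hy, hU⟩ := ihy
    exact ⟨T ∪ U, mul_mem (Subgroup.closure_mono (by simp) hx) (Subgroup.closure_mono (by simp) hy),
      by simp [hT, hU]⟩
  | inv x _ ih => exact ih.imp fun T hT => ⟨inv_mem hT.1, hT.2⟩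

lemma Subgroup.isCompactElement_top [Group.FG G] : IsCompactElement (⊤ : Subgroup G) := by
  obtain ⟨T, hT⟩ := Group.fg_def.1 ‹Group.FG G›
  intro s u hs hd hu htop
  obtain rfl := hu.sSup_eq
  have h : ∀ U : Finset G, ∃ K ∈ s, (U : Set G) ⊆ K := by
    classical
    intro U
    induction U using Finset.induction_on with
    | empty => exact hs.imp fun K hK => ⟨hK, by simp⟩
    | insert x U _ ih =>
      obtain ⟨K, hK, hUK⟩ := ih
      obtain ⟨L, hL, hxL⟩ := (Subgroup.mem_sSup_of_directedOn hs hd).1 (htop (Subgroup.mem_top x))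
      obtain ⟨N, hN, hKN, hLN⟩ := hd K hK L hL
      exact ⟨N, hN, by simpa [Set.insert_subset_iff] using ⟨hLN hxL, hUK.trans hKN⟩⟩
  obtain ⟨K, hK, hTK⟩ := h T
  exact ⟨K, hK, by rwa [← hT, Subgroup.closure_le]⟩

lemma Subgroup.isCoatom_iff_closure_insert {M : Subgroup G} :
    IsCoatom M ↔ (∃ g, g ∉ M) ∧ ∀ g, g ∉ M → ∀ x, x ∈ Subgroup.closure (insert g (M : Set G)) := by
  rw [IsCoatom, Ne, Subgroup.eq_top_iff']
  push Not
  refine and_congr_right fun _ => ⟨fun h g hg x => ?_, fun h K hK => ?_⟩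
  · rw [h _ (SetLike.lt_iff_le_and_exists.2 ⟨fun y hy => Subgroup.subset_closure (.inr hy), g,
      Subgroup.subset_closure (.inl rfl), hg⟩)]
    trivial
  · obtain ⟨hle, g, hgK, hgM⟩ := SetLike.lt_iff_le_and_exists.1 hK
    exact (Subgroup.eq_top_iff' K).2 fun x =>
      (Subgroup.closure_le K).2 (Set.insert_subset hgK hle) (h g hgM x)

variable [Countable G]

lemma measurable_mem_closure {α : Type*} [MeasurableSpace α] {f : α → Set G} (hf : Measurable f)
    (x : G) : Measurable fun a => x ∈ Subgroup.closure (f a) := by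
  rw [measurable_set_iff] at hf
  have h : (fun a => x ∈ Subgroup.closure (f a)) = fun a =>
      ∃ T : Finset G, x ∈ Subgroup.closure (T : Set G) ∧ ∀ y ∈ T, y ∈ f a :=
    funext fun a => propext Subgroup.mem_closure_iff_exists_finset
  rw [h]
  exact .exists fun T => measurable_const.and (.forall fun y => measurable_const.imp (hf y))

lemma measurableSet_isCoatom :
    MeasurableSet {S : Set G | ∃ M : Subgroup G, IsCoatom M ∧ (M : Set G) = S} := by
  have h : {S : Set G | ∃ M : Subgroup G, IsCoatom M ∧ (M : Set G) = S} =
      {S : Set G | (∀ x, x ∈ Subgroup.closure S → x ∈ S) ∧ (∃ g, g ∉ S) ∧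
        ∀ g, g ∉ S → ∀ x, x ∈ Subgroup.closure (insert g S)} := by
    ext S
    constructor
    · rintro ⟨M, hM, rfl⟩
      exact ⟨by simp, Subgroup.isCoatom_iff_closure_insert.1 hM⟩
    · rintro ⟨h1, h2⟩
      have h : (Subgroup.closure S : Set G) = S := Set.Subset.antisymm h1 Subgroup.subset_closure
      refine ⟨Subgroup.closure S, Subgroup.isCoatom_iff_closure_insert.2 ?_, h⟩
      have hmem : ∀ g, g ∈ Subgroup.closure S ↔ g ∈ S := fun g => Set.ext_iff.1 h g
      simp_rw [hmem, h]
      exact h2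
  have hmem : ∀ x : G, Measurable fun S : Set G => x ∈ S := measurable_set_iff.1 measurable_id
  have hins : ∀ g : G, Measurable fun S : Set G => insert g S := fun g =>
    measurable_set_iff.2 fun x => by
      simp only [Set.mem_insert_iff]
      exact measurable_const.or (hmem x)
  rw [h, measurableSet_setOfPred]
  exact (Measurable.forall fun x => (measurable_mem_closure measurable_id x).imp (hmem x)).and
    ((Measurable.exists fun g => (hmem g).not).and (.forall fun g => (hmem g).not.imp
      (.forall fun x => measurable_mem_closure (hins g) x)))

end Measurability

lemma mk_eq_continuum_of_measurableSet {α : Type} [MeasurableSpace α] [StandardBorelSpace α]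
    {S : Set α} (hS : MeasurableSet S) (hc : ¬ S.Countable) : Cardinal.mk S = Cardinal.continuum :=
    by
  have := hS.standardBorel
  rw [Cardinal.mk_congr (PolishSpace.measurableEquivNatBoolOfNotCountable (α := S) hc).toEquiv]
  simp

section Mixed
variable {ι : Type} [Fintype ι] [DecidableEq ι] {p q : ι}

instance : Countable (SpecialLinearGroup ι ℤ) :=
  have : Countable (Matrix ι ι ℤ) := inferInstanceAs (Countable (ι → ι → ℤ))
  inferInstanceAs (Countable {A : Matrix ι ι ℤ // A.det = 1})

instance : Group.FG (SpecialLinearGroup ι ℤ) := by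
  have h : (SpecialLinearGroup.elementary ι).Finite := by
    refine (Set.finite_range fun x : {x : ι × ι // x.1 ≠ x.2} =>
      (SpecialLinearGroup.transvection x.2 1 : SpecialLinearGroup ι ℤ)).subset ?_
    rintro _ ⟨a, b, h, rfl⟩
    exact ⟨⟨(a, b), h⟩, rfl⟩
  exact Group.fg_iff.2 ⟨_, SpecialLinearGroup.closure_elementary, h⟩

lemma exists_isCoatom_isMixed (hpq : p ≠ q) (h3 : 3 ≤ Fintype.card ι)
    {C : Set (Subgroup (SpecialLinearGroup ι ℤ))} (hC : C.Countable) (htop : ⊤ ∉ C) :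
    ∃ M : Subgroup (SpecialLinearGroup ι ℤ), IsCoatom M ∧ IsMixed hpq M ∧ M ∉ C := by
  let conjs : {x : ℕ × ι × ι // 2 ≤ x.1 ∧ x.2.1 ≠ x.2.2} → Set (SpecialLinearGroup ι ℤ) := fun x =>
    Set.range fun k => mixer hpq x.1.1 k * SpecialLinearGroup.transvection x.2.2 1 *
      (mixer hpq x.1.1 k)⁻¹
  obtain ⟨H, hH, hmeet⟩ := exists_proper_subgroup_meeting hpq h3
    (𝓡 := Set.range conjs ∪ 
      (fun M : Subgroup (SpecialLinearGroup ι ℤ) => (M : Set (SpecialLinearGroup ι ℤ))ᶜ) '' C)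
    ⟨_, .inl ⟨⟨(2, p, q), le_rfl, hpq⟩, rfl⟩⟩ ((Set.countable_range _).union (hC.image _)) (by
      rintro _ (⟨x, rfl⟩ | ⟨M, hM, rfl⟩)
      · exact large_range_conj hpq h3 x.2.1 x.2.2
      · exact large_compl hpq h3 fun h => htop (h ▸ hM))
  have := CompleteLattice.coatomic_of_top_compact
    (Subgroup.isCompactElement_top (G := SpecialLinearGroup ι ℤ))
  obtain ⟨M, hM, hHM⟩ := (eq_top_or_exists_le_coatom H).resolve_left hH
  refine ⟨M, hM, fun m hm a b h => ?_, fun hMC => ?_⟩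
  · obtain ⟨_, hg, k, rfl⟩ := hmeet _ (.inl ⟨⟨(m, a, b), hm, h⟩, rfl⟩)
    exact ⟨k, hHM hg⟩
  · obtain ⟨g, hg, hgM⟩ := hmeet _ (.inr ⟨M, hMC, rfl⟩)
    exact hgM (hHM hg)

lemma measurableSet_isMixed (hpq : p ≠ q) :
    MeasurableSet {S : Set (SpecialLinearGroup ι ℤ) | ∀ m, 2 ≤ m → ∀ (a b : ι) (h : a ≠ b), ∃ k,
      mixer hpq m k * SpecialLinearGroup.transvection h 1 * (mixer hpq m k)⁻¹ ∈ S} := by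
  have hmem : ∀ x : SpecialLinearGroup ι ℤ,
      Measurable fun S : Set (SpecialLinearGroup ι ℤ) => x ∈ S :=
    measurable_set_iff.1 measurable_id
  rw [measurableSet_setOfPred]
  exact .forall fun m => .forall fun _ => .forall fun a => .forall fun b => .forall fun h =>
    .exists fun k => hmem _

lemma mk_isCoatom_isMixed (hpq : p ≠ q) (h3 : 3 ≤ Fintype.card ι) :
    Cardinal.mk {M : Subgroup (SpecialLinearGroup ι ℤ) // IsCoatom M ∧ IsMixed hpq M} =
      Cardinal.continuum := by
  set 𝓜 : Set (Subgroup (SpecialLinearGroup ι ℤ)) := {M | IsCoatom M ∧ IsMixed hpq M}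
  have : StandardBorelSpace (Set (SpecialLinearGroup ι ℤ)) :=
    inferInstanceAs (StandardBorelSpace (SpecialLinearGroup ι ℤ → Prop))
  have himage : (SetLike.coe '' 𝓜 : Set (Set (SpecialLinearGroup ι ℤ))) =
      {S | ∃ M : Subgroup (SpecialLinearGroup ι ℤ), IsCoatom M ∧ (M : Set _) = S} ∩
      {S | ∀ m, 2 ≤ m → ∀ (a b : ι) (h : a ≠ b), ∃ k,
        mixer hpq m k * SpecialLinearGroup.transvection h 1 * (mixer hpq m k)⁻¹ ∈ S} := by
    ext S
    constructor
    · rintro ⟨M, hM, rfl⟩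
      exact ⟨⟨M, hM.1, rfl⟩, hM.2⟩
    · rintro ⟨⟨M, hM, rfl⟩, hS⟩
      exact ⟨M, ⟨hM, hS⟩, rfl⟩
  change Cardinal.mk 𝓜 = _
  rw [← Cardinal.mk_image_eq (s := 𝓜) SetLike.coe_injective, himage]
  refine mk_eq_continuum_of_measurableSet (measurableSet_isCoatom.inter (measurableSet_isMixed hpq))
    fun hct => ?_
  rw [← himage] at hct
  obtain ⟨M, hM, hmix, hnot⟩ := exists_isCoatom_isMixed hpq h3
    (Set.countable_of_injective_of_countable_image SetLike.coe_injective.injOn hct)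
    (fun h => h.1.1 rfl)
  exact hnot ⟨hM, hmix⟩

end Mixed

/-- For `n ≥ 3` there exist continuum many profinitely dense infinite-index
subgroups of `SL(n,ℤ)` such that any two distinct ones generate `SL(n,ℤ)`. -/
theorem continuum_many_profinitely_dense_subgroups (n : ℕ) (hn : 3 ≤ n) :
    ∃ (I : Type) (H : I → Subgroup (SLZ n)),
      Cardinal.mk I = Cardinal.continuum ∧ Function.Injective H ∧
      (∀ i, ProfinitelyDense (H i) ∧ (H i).index = 0) ∧
      (∀ i j, i ≠ j → H i ⊔ H j = ⊤) := by
  have hpq : (⟨0, by omega⟩ : Fin n) ≠ ⟨1, by omega⟩ := by simp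
  refine ⟨{M : Subgroup (SLZ n) // IsCoatom M ∧ IsMixed hpq M}, Subtype.val,
    mk_isCoatom_isMixed hpq (by simpa using hn), Subtype.val_injective, fun M => ⟨fun N _ _ =>
      M.2.2.sup_eq_top N, M.2.2.index_eq_zero M.2.1.1⟩, fun M N hMN => ?_⟩
  exact M.2.1.sup_eq_top_of_ne N.2.1 (Subtype.val_injective.ne hMN)
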